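/- The su_q^P(3) coproduct respects the brackets generating the non-simple roots: as functions on ℝ⁹×ℝ⁹ one has {Δ(a₁₂), Δ(a₂₃)} = Δ(a₁₃) and {Δ(a₃₂), Δ(a₂₁)} = Δ(a₃₁), where the brackets on the left are the product Poisson bracket. -/

import Mathlib

/-- Partial derivative of a function on ℝ⁹ in the `i`-th coordinate direction.
Coordinates: (x 0,…,x 8) = (h₁,h₂,h₃,a₁₂,a₂₁,a₂₃,a₃₂,a₁₃,a₃₁). -/
noncomputable def pd (i : Fin 9) (f : (Fin 9 → ℝ) → ℝ) (x : Fin 9 → ℝ) : ℝ :=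
  fderiv ℝ f x (Pi.single i 1)

/-- The structure functions π(u,v) of su_q^P(3) for u < v (zero otherwise);
indices: 0=h₁, 1=h₂, 2=h₃, 3=a₁₂, 4=a₂₁, 5=a₂₃, 6=a₃₂, 7=a₁₃, 8=a₃₁. -/
noncomputable def piU (z : ℝ) (u v : ℕ) (x : Fin 9 → ℝ) : ℝ :=
  match u, v with
  | 0, 3 => x 3
  | 0, 4 => -x 4
  | 0, 7 => x 7
  | 0, 8 => -x 8
  | 1, 3 => -x 3
  | 1, 4 => x 4
  | 1, 5 => x 5
  | 1, 6 => -x 6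
  | 2, 5 => -x 5
  | 2, 6 => x 6
  | 2, 7 => -x 7
  | 2, 8 => x 8
  | 3, 4 => Real.sinh (z * (x 0 - x 1)) / z
  | 3, 5 => x 7
  | 3, 7 => z ^ 2 * x 3 ^ 2 * x 5
  | 3, 8 => -(Real.cosh (z * (x 0 - x 1)) * x 6)
  | 4, 6 => -x 8
  | 4, 7 => Real.cosh (z * (x 0 - x 1)) * x 5
  | 4, 8 => -(z ^ 2 * x 4 ^ 2 * x 6)
  | 5, 6 => Real.sinh (z * (x 1 - x 2)) / z
  | 5, 7 => -(z ^ 2 * x 5 ^ 2 * x 3)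
  | 5, 8 => Real.cosh (z * (x 1 - x 2)) * x 4
  | 6, 7 => -(Real.cosh (z * (x 1 - x 2)) * x 3)
  | 6, 8 => z ^ 2 * x 6 ^ 2 * x 4
  | 7, 8 => Real.sinh (z * (x 0 - x 2)) / z
      + z * Real.sinh (z * (x 0 - x 1)) * x 5 * x 6
      + z * Real.sinh (z * (x 1 - x 2)) * x 3 * x 4
  | _, _ => 0

/-- The bracket of the q-Poisson algebra su_q^P(3):
{f,g} = Σ_{u<v} π(u,v)(∂_u f ∂_v g − ∂_v f ∂_u g). -/
noncomputable def suq3Bracket (z : ℝ) (f g : (Fin 9 → ℝ) → ℝ) (x : Fin 9 → ℝ) : ℝ :=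
  ∑ u : Fin 9, ∑ v : Fin 9,
    if u < v then piU z u.val v.val x * (pd u f x * pd v g x - pd v f x * pd u g x)
    else 0

/-- The product Poisson bracket on ℝ⁹ × ℝ⁹. -/
noncomputable def suq3Bracket2 (z : ℝ) (F G : (Fin 9 → ℝ) × (Fin 9 → ℝ) → ℝ)
    (p : (Fin 9 → ℝ) × (Fin 9 → ℝ)) : ℝ :=
  suq3Bracket z (fun y => F (y, p.2)) (fun y => G (y, p.2)) p.1
  + suq3Bracket z (fun y => F (p.1, y)) (fun y => G (p.1, y)) p.2

/-- Coproduct Δ(hᵢ) = hᵢ + hᵢ' (i = 0,1,2 standing for 1,2,3). -/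
noncomputable def Dh (i : Fin 3) : (Fin 9 → ℝ) × (Fin 9 → ℝ) → ℝ := fun p =>
  p.1 ⟨i.val, by omega⟩ + p.2 ⟨i.val, by omega⟩

/-- Coproduct Δ(a₁₂). -/
noncomputable def Da12 (z : ℝ) : (Fin 9 → ℝ) × (Fin 9 → ℝ) → ℝ := fun p =>
  Real.exp (z * (p.1 0 - p.1 1) / 2) * p.2 3
  + p.1 3 * Real.exp (-(z * (p.2 0 - p.2 1) / 2))

/-- Coproduct Δ(a₂₁). -/
noncomputable def Da21 (z : ℝ) : (Fin 9 → ℝ) × (Fin 9 → ℝ) → ℝ := fun p =>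
  Real.exp (z * (p.1 0 - p.1 1) / 2) * p.2 4
  + p.1 4 * Real.exp (-(z * (p.2 0 - p.2 1) / 2))

/-- Coproduct Δ(a₂₃). -/
noncomputable def Da23 (z : ℝ) : (Fin 9 → ℝ) × (Fin 9 → ℝ) → ℝ := fun p =>
  Real.exp (z * (p.1 1 - p.1 2) / 2) * p.2 5
  + p.1 5 * Real.exp (-(z * (p.2 1 - p.2 2) / 2))

/-- Coproduct Δ(a₃₂). -/
noncomputable def Da32 (z : ℝ) : (Fin 9 → ℝ) × (Fin 9 → ℝ) → ℝ := fun p =>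
  Real.exp (z * (p.1 1 - p.1 2) / 2) * p.2 6
  + p.1 6 * Real.exp (-(z * (p.2 1 - p.2 2) / 2))

/-- Coproduct Δ(a₁₃). -/
noncomputable def Da13 (z : ℝ) : (Fin 9 → ℝ) × (Fin 9 → ℝ) → ℝ := fun p =>
  Real.exp (z * (p.1 0 - p.1 2) / 2) * p.2 7
  + p.1 7 * Real.exp (-(z * (p.2 0 - p.2 2) / 2))
  + z * (Real.exp (z * (p.1 1 - p.1 2) / 2) * p.1 3
           * (Real.exp (-(z * (p.2 0 - p.2 1) / 2)) * p.2 5)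
         - Real.exp (z * (p.1 0 - p.1 1) / 2) * p.1 5
           * (Real.exp (-(z * (p.2 1 - p.2 2) / 2)) * p.2 3))

/-- Coproduct Δ(a₃₁). -/
noncomputable def Da31 (z : ℝ) : (Fin 9 → ℝ) × (Fin 9 → ℝ) → ℝ := fun p =>
  Real.exp (z * (p.1 0 - p.1 2) / 2) * p.2 8
  + p.1 8 * Real.exp (-(z * (p.2 0 - p.2 2) / 2))
  + z * (Real.exp (z * (p.1 1 - p.1 2) / 2) * p.1 4
           * (Real.exp (-(z * (p.2 0 - p.2 1) / 2)) * p.2 6)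
         - Real.exp (z * (p.1 0 - p.1 1) / 2) * p.1 6
           * (Real.exp (-(z * (p.2 1 - p.2 2) / 2)) * p.2 4))

/-- Partial derivatives of a root vector coproduct, as a function of one of its two arguments. -/
theorem pd_exp_mul_add_mul (u i j k : Fin 9) (c A B : ℝ) (x : Fin 9 → ℝ) :
    pd u (fun y => Real.exp (c * (y i - y j) / 2) * A + y k * B) x =
      Real.exp (c * (x i - x j) / 2)
          * (c * ((Pi.single u 1 : Fin 9 → ℝ) i - (Pi.single u 1 : Fin 9 → ℝ) j) / 2) * A
        + (Pi.single u 1 : Fin 9 → ℝ) k * B := by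
  have proj (l : Fin 9) : HasFDerivAt (fun y : Fin 9 → ℝ => y l)
      (ContinuousLinearMap.proj (R := ℝ) l) x := hasFDerivAt_apply l x
  have h := ((((((proj i).sub (proj j)).const_mul c).mul_const (2⁻¹ : ℝ)).exp.mul_const A).add
    ((proj k).mul_const B))
  simp only [pd, div_eq_mul_inv]
  refine (congrArg (fun L => L (Pi.single u 1)) (HasFDerivAt.fderiv h)).trans ?_
  simp
  ring

/-- The bracket of functions affine in `a₁₂` and `a₂₃` respectively. -/
theorem suq3Bracket_a12_a23 (z c A B d C D : ℝ) (x : Fin 9 → ℝ) :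
    suq3Bracket z (fun y => Real.exp (c * (y 0 - y 1) / 2) * A + y 3 * B)
      (fun y => Real.exp (d * (y 1 - y 2) / 2) * C + y 5 * D) x =
    x 7 * B * D - c / 2 * Real.exp (c * (x 0 - x 1) / 2) * x 5 * A * D
      + d / 2 * Real.exp (d * (x 1 - x 2) / 2) * x 3 * B * C := by
  simp only [suq3Bracket, pd_exp_mul_add_mul]
  simp [Fin.sum_univ_succ, piU, Pi.single_apply]
  ring

/-- The bracket of functions affine in `a₃₂` and `a₂₁` respectively. -/
theorem suq3Bracket_a32_a21 (z c A B d C D : ℝ) (x : Fin 9 → ℝ) :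
    suq3Bracket z (fun y => Real.exp (c * (y 1 - y 2) / 2) * A + y 6 * B)
      (fun y => Real.exp (d * (y 0 - y 1) / 2) * C + y 4 * D) x =
    x 8 * B * D + c / 2 * Real.exp (c * (x 1 - x 2) / 2) * x 4 * A * D
      - d / 2 * Real.exp (d * (x 0 - x 1) / 2) * x 6 * B * C := by
  simp only [suq3Bracket, pd_exp_mul_add_mul]
  simp [Fin.sum_univ_succ, piU, Pi.single_apply]
  ring

/-- Exponentials attached to consecutive simple roots multiply to that of their sum. -/
theorem exp_simple_root_mul (c a b d : ℝ) :
    Real.exp (c * (a - d) / 2) = Real.exp (c * (a - b) / 2) * Real.exp (c * (b - d) / 2) := by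
  rw [← Real.exp_add]
  ring_nf

/-- the su_q^P(3) coproduct respects the brackets generating the
non-simple roots: {Δ(a₁₂), Δ(a₂₃)} = Δ(a₁₃) and {Δ(a₃₂), Δ(a₂₁)} = Δ(a₃₁). -/
theorem suq3_coproduct_nonsimple (z : ℝ) (hz : z ≠ 0) :
    (∀ p : (Fin 9 → ℝ) × (Fin 9 → ℝ),
      suq3Bracket2 z (Da12 z) (Da23 z) p = Da13 z p) ∧
    (∀ p : (Fin 9 → ℝ) × (Fin 9 → ℝ),
      suq3Bracket2 z (Da32 z) (Da21 z) p = Da31 z p) := by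
  have neg_exp (a b : ℝ) : -(z * (a - b) / 2) = -z * (a - b) / 2 := by ring
  have swap (a b c d : ℝ) : a * b + c * d = d * c + b * a := by ring
  constructor <;> rintro ⟨x, y⟩
  · have first := suq3Bracket_a12_a23 z z (y 3) (Real.exp (-z * (y 0 - y 1) / 2))
      z (y 5) (Real.exp (-z * (y 1 - y 2) / 2)) x
    have second := suq3Bracket_a12_a23 z (-z) (x 3) (Real.exp (z * (x 0 - x 1) / 2))
      (-z) (x 5) (Real.exp (z * (x 1 - x 2) / 2)) y
    simp only [← swap (Real.exp (z * _ / 2))] at second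
    simp only [suq3Bracket2, Da12, Da23, Da13, neg_exp]
    rw [first, second, exp_simple_root_mul z (x 0) (x 1) (x 2), exp_simple_root_mul (-z) (y 0) (y 1) (y 2)]
    ring
  · have first := suq3Bracket_a32_a21 z z (y 6) (Real.exp (-z * (y 1 - y 2) / 2))
      z (y 4) (Real.exp (-z * (y 0 - y 1) / 2)) x
    have second := suq3Bracket_a32_a21 z (-z) (x 6) (Real.exp (z * (x 1 - x 2) / 2))
      (-z) (x 4) (Real.exp (z * (x 0 - x 1) / 2)) y
    simp only [← swap (Real.exp (z * _ / 2))] at second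
    simp only [suq3Bracket2, Da32, Da21, Da31, neg_exp]
    rw [first, second, exp_simple_root_mul z (x 0) (x 1) (x 2), exp_simple_root_mul (-z) (y 0) (y 1) (y 2)]
    ring
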